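/- arXiv:2303.04002 — 12 statements merged into one kernel-verified Lean document; each statement's English description precedes it below -/
import Mathlib

section
/- Let k ≥ 1 and N ≥ 1 be natural numbers, let M be an N×N real symmetric matrix, and let ε be a nonzero real number such that the matrix j·ε·I + M is invertible for every j = 0, 1, …, k. Setting A_j := (j·ε·I + M)⁻¹, one has A_0 · A_1 · ⋯ · A_k = (1/(ε^k · k!)) · ∑_{j=0}^{k} (−1)^j · (k choose j) · A_j. -/
/-- A sequence satisfying the resolvent identity on an arithmetic progression of step `ε` has
consecutive products given by the alternating binomial partial fraction expansion. -/
theorem prod_range_eq_of_resolvent_identity {K R : Type*} [Field K] [CharZero K] [Ring R]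
    [Algebra K R] {ε : K} (hε : ε ≠ 0) (A : ℕ → R) (k : ℕ)
    (h : ∀ i j : ℕ, i < j → j ≤ k → (((j : K) - i) * ε) • (A i * A j) = A i - A j) :
    ((List.range (k + 1)).map A).prod =
      (1 / (ε ^ k * (k.factorial : K))) •
        ∑ j ∈ Finset.range (k + 1), ((-1 : K) ^ j * (k.choose j : K)) • A j := by
  induction k with
  | zero => simp
  | succ k ih =>
    have alternating_sum :
        ∑ j ∈ Finset.range (k + 1), (-1 : K) ^ j * ((k + 1).choose j : K) = -(-1) ^ (k + 1) := by
      have hsum := congrArg (Int.cast : ℤ → K)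
        (Int.alternating_sum_range_choose_of_ne k.succ_ne_zero)
      push_cast [Finset.sum_range_succ _ (k + 1)] at hsum
      simp only [Nat.succ_eq_add_one, Nat.choose_self, Nat.cast_one, mul_one] at hsum
      exact eq_neg_of_add_eq_zero_left hsum
    rw [List.range_succ, List.map_append, List.prod_append,
      ih fun i j hij hj => h i j hij (hj.trans k.le_succ)]
    simp only [List.map_cons, List.map_nil, List.prod_cons, List.prod_nil, mul_one]
    have term_mul : ∀ j ∈ Finset.range (k + 1),
        (1 / (ε ^ k * (k.factorial : K))) • (((-1 : K) ^ j * (k.choose j : K)) • A j * A (k + 1)) =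
          (1 / (ε ^ (k + 1) * ((k + 1).factorial : K))) •
            (((-1 : K) ^ j * ((k + 1).choose j : K)) • (A j - A (k + 1))) := by
      intro j hj
      have hjk : j ≤ k := Nat.lt_succ_iff.mp (Finset.mem_range.mp hj)
      have hchoose : (k.choose j : K) * (k + 1) = ((k + 1).choose j : K) * (k + 1 - j) := by
        have := congrArg (Nat.cast : ℕ → K) (Nat.choose_mul_succ_eq k j)
        push_cast [Nat.cast_sub (hjk.trans k.le_succ)] at this
        exact this
      have hk : (k : K) + 1 ≠ 0 := k.cast_add_one_ne_zero
      have hfac : (k.factorial : K) ≠ 0 := Nat.cast_ne_zero.mpr k.factorial_ne_zero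
      rw [← h j (k + 1) (Nat.lt_succ_of_le hjk) le_rfl, smul_mul_assoc, smul_smul, smul_smul,
        smul_smul, Nat.factorial_succ]
      congr 1
      push_cast
      field_simp
      linear_combination ε ^ (k + 1) * hchoose
    rw [smul_mul_assoc, Finset.sum_mul, Finset.smul_sum, Finset.sum_congr rfl term_mul,
      ← Finset.smul_sum, Finset.sum_range_succ _ (k + 1)]
    simp only [smul_sub, Finset.sum_sub_distrib, ← Finset.sum_smul]
    rw [alternating_sum]
    simp [sub_eq_add_neg]

theorem Matrix.smul_inv_mul_inv_eq_sub {n K : Type*} [Fintype n] [DecidableEq n] [CommRing K]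
    (M : Matrix n n K) {a b : K} (ha : IsUnit (a • (1 : Matrix n n K) + M))
    (hb : IsUnit (b • (1 : Matrix n n K) + M)) :
    (b - a) • ((a • 1 + M)⁻¹ * (b • 1 + M)⁻¹) = (a • 1 + M)⁻¹ - (b • 1 + M)⁻¹ := by
  rw [Matrix.inv_sub_inv (iff_of_true ha hb), add_sub_add_right_eq_sub, ← sub_smul]
  simp

theorem stmt_0 (k N : ℕ) (hk : 1 ≤ k) (hN : 1 ≤ N)
    (M : Matrix (Fin N) (Fin N) ℝ) (hM : M.IsSymm)
    (ε : ℝ) (hε : ε ≠ 0)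
    (hinv : ∀ j : ℕ, j ≤ k →
      IsUnit (((j : ℝ) * ε) • (1 : Matrix (Fin N) (Fin N) ℝ) + M)) :
    ((List.range (k + 1)).map
        (fun j => (((j : ℝ) * ε) • (1 : Matrix (Fin N) (Fin N) ℝ) + M)⁻¹)).prod
      = (1 / (ε ^ k * (Nat.factorial k : ℝ))) •
        ∑ j ∈ Finset.range (k + 1),
          ((-1 : ℝ) ^ j * (Nat.choose k j : ℝ)) •
            (((j : ℝ) * ε) • (1 : Matrix (Fin N) (Fin N) ℝ) + M)⁻¹ := by
  have hprod := prod_range_eq_of_resolvent_identity hε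
    (fun j : ℕ => (((j : ℝ) * ε) • (1 : Matrix (Fin N) (Fin N) ℝ) + M)⁻¹) k fun i j hij hj => by
      rw [sub_mul]
      exact M.smul_inv_mul_inv_eq_sub (hinv i (hij.le.trans hj)) (hinv j hj)
  rw [← hprod, List.bind_eq_flatMap]
  simp only [List.pure_def, ← List.map_eq_flatMap, List.map_map,
    Function.comp_def]
end

section
/- Let σ > 0, 0 < Δ < σ, and let μ be a nonzero real number. Then there exists a real λ with |λ| > 2σ satisfying λ − μ = Δ²·𝔤_σ(λ) if and only if |μ| > 2σ − Δ²/σ. In that case the solution is unique, satisfies sign(λ) = sign(μ), and is given explicitly by λ = (2μσ² − Δ²μ − sign(μ)·Δ²·√(μ² − 4(σ² − Δ²))) / (2(σ² − Δ²)). -/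
/-- The Stieltjes transform of the semicircle law of variance `s ^ 2`,
    `𝔤_s(l) = (l - sign(l) * √(l² - 4 s²)) / (2 s²)`, for real `l` with `|l| > 2 s`. -/
noncomputable def stieltjes (s l : ℝ) : ℝ :=
  (l - Real.sign l * Real.sqrt (l ^ 2 - 4 * s ^ 2)) / (2 * s ^ 2)

theorem stieltjes_neg (s l : ℝ) : stieltjes s (-l) = -stieltjes s l := by
  simp only [stieltjes, Real.sign_neg, neg_sq]
  ring

/-- The Joukowski parametrization `l = u + s² / u` with `u > s` rationalizes the Stieltjes
transform. -/
theorem stieltjes_add_sq_div {s u : ℝ} (hs : 0 < s) (hu : s < u) :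
    stieltjes s (u + s ^ 2 / u) = 1 / u := by
  have hu0 : 0 < u := hs.trans hu
  have hpos : 0 < u + s ^ 2 / u := by positivity
  have hle : s ^ 2 / u ≤ u := by
    rw [div_le_iff₀ hu0]
    nlinarith
  have hsq : (u + s ^ 2 / u) ^ 2 - 4 * s ^ 2 = (u - s ^ 2 / u) ^ 2 := by
    field_simp
    ring
  rw [stieltjes, Real.sign_of_pos hpos, hsq, Real.sqrt_sq (sub_nonneg.2 hle)]
  field_simp
  ring

/-- The larger root `u` of `u ^ 2 - m * u + a = 0`. -/
theorem exists_add_div_eq {c a m : ℝ} (hc : 0 < c) (hm : c + a / c < m) :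
    ∃ u, c < u ∧ u + a / u = m := by
  have hm' : c ^ 2 + a < m * c := by
    have h := mul_lt_mul_of_pos_right hm hc
    have h' : (c + a / c) * c = c ^ 2 + a := by field_simp
    linarith
  have hlt : 2 * c - m < √(m ^ 2 - 4 * a) := by
    rcases lt_or_ge (2 * c - m) 0 with h | h
    · exact h.trans_le (Real.sqrt_nonneg _)
    · exact Real.lt_sqrt_of_sq_lt (by nlinarith)
  have hdisc : 0 ≤ m ^ 2 - 4 * a := by
    nlinarith [sq_nonneg (m - 2 * c)]
  have hcu : c < (m + √(m ^ 2 - 4 * a)) / 2 := by linarith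
  refine ⟨(m + √(m ^ 2 - 4 * a)) / 2, hcu, ?_⟩
  have hs := Real.sq_sqrt hdisc
  have hne : m + √(m ^ 2 - 4 * a) ≠ 0 := by linarith
  field_simp
  nlinarith

theorem exists_sub_eq_stieltjes {σ Δ μ : ℝ} (hσ : 0 < σ) (h : 2 * σ - Δ ^ 2 / σ < μ) :
    ∃ l, 2 * σ < l ∧ l - μ = Δ ^ 2 * stieltjes σ l := by
  have hm : σ + (σ ^ 2 - Δ ^ 2) / σ < μ := by
    convert h using 1
    field_simp
    ring
  obtain ⟨u, hu, rfl⟩ := exists_add_div_eq hσ hm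
  have hu0 : 0 < u := hσ.trans hu
  refine ⟨u + σ ^ 2 / u, ?_, ?_⟩
  · have h2 : u + σ ^ 2 / u - 2 * σ = (u - σ) ^ 2 / u := by
      field_simp
      ring
    have h3 : 0 < (u - σ) ^ 2 / u := div_pos (pow_pos (sub_pos.2 hu) 2) hu0
    linarith
  · rw [stieltjes_add_sq_div hσ hu]
    field_simp
    ring

theorem of_sub_eq_stieltjes {σ Δ μ l : ℝ} (hσ : 0 < σ) (hΔ0 : 0 < Δ) (hΔσ : Δ < σ)
    (hl : 2 * σ < l) (h : l - μ = Δ ^ 2 * stieltjes σ l) :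
    2 * σ - Δ ^ 2 / σ < μ ∧
      l = (2 * μ * σ ^ 2 - Δ ^ 2 * μ - Δ ^ 2 * √(μ ^ 2 - 4 * (σ ^ 2 - Δ ^ 2))) /
        (2 * (σ ^ 2 - Δ ^ 2)) := by
  have hl' : σ + σ ^ 2 / σ < l := by
    convert hl using 1
    field_simp
    ring
  obtain ⟨u, hu, rfl⟩ := exists_add_div_eq hσ hl'
  have hu0 : 0 < u := hσ.trans hu
  have ha : 0 < σ ^ 2 - Δ ^ 2 := by nlinarith
  rw [stieltjes_add_sq_div hσ hu] at h
  obtain rfl : μ = u + (σ ^ 2 - Δ ^ 2) / u := by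
    rw [sub_div]
    linear_combination -h
  have hle : (σ ^ 2 - Δ ^ 2) / u ≤ u := by
    rw [div_le_iff₀ hu0]
    nlinarith
  have hsq : (u + (σ ^ 2 - Δ ^ 2) / u) ^ 2 - 4 * (σ ^ 2 - Δ ^ 2) =
      (u - (σ ^ 2 - Δ ^ 2) / u) ^ 2 := by
    field_simp
    ring
  constructor
  · have h2 : u + (σ ^ 2 - Δ ^ 2) / u - (2 * σ - Δ ^ 2 / σ) =
        (u - σ) * (σ * (u - σ) + Δ ^ 2) / (σ * u) := by
      field_simp
      ring
    have hd : 0 < u - σ := sub_pos.2 hu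
    have h3 : 0 < (u - σ) * (σ * (u - σ) + Δ ^ 2) / (σ * u) := by positivity
    linarith
  · rw [hsq, Real.sqrt_sq (sub_nonneg.2 hle), eq_div_iff (by positivity)]
    field_simp
    ring

theorem stmt_1 (σ Δ μ : ℝ) (hσ : 0 < σ) (hΔ0 : 0 < Δ) (hΔσ : Δ < σ) (hμ : μ ≠ 0) :
    ((∃ l : ℝ, 2 * σ < |l| ∧ l - μ = Δ ^ 2 * stieltjes σ l) ↔ 2 * σ - Δ ^ 2 / σ < |μ|) ∧
    (∀ l : ℝ, 2 * σ < |l| → l - μ = Δ ^ 2 * stieltjes σ l →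
      Real.sign l = Real.sign μ ∧
      l = (2 * μ * σ ^ 2 - Δ ^ 2 * μ -
            Real.sign μ * Δ ^ 2 * Real.sqrt (μ ^ 2 - 4 * (σ ^ 2 - Δ ^ 2))) /
          (2 * (σ ^ 2 - Δ ^ 2))) := by
  have hb : 0 < 2 * σ - Δ ^ 2 / σ := by
    have : Δ ^ 2 / σ < σ := by
      rw [div_lt_iff₀ hσ]
      nlinarith
    linarith
  have neg_eq {l : ℝ} (h : l - μ = Δ ^ 2 * stieltjes σ l) :
      -l - -μ = Δ ^ 2 * stieltjes σ (-l) := by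
    rw [stieltjes_neg]
    linear_combination -h
  refine ⟨⟨?_, fun h => ?_⟩, fun l hl h => ?_⟩
  · rintro ⟨l, hl, h⟩
    rcases lt_abs.1 hl with hl | hl
    · exact lt_abs.2 (.inl (of_sub_eq_stieltjes hσ hΔ0 hΔσ hl h).1)
    · exact lt_abs.2 (.inr (of_sub_eq_stieltjes hσ hΔ0 hΔσ hl (neg_eq h)).1)
  · rcases lt_abs.1 h with h | h
    · obtain ⟨l, hl, e⟩ := exists_sub_eq_stieltjes hσ h
      exact ⟨l, lt_abs.2 (.inl hl), e⟩
    · obtain ⟨l, hl, e⟩ := exists_sub_eq_stieltjes hσ h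
      refine ⟨-l, lt_abs.2 (.inr (by rwa [neg_neg])), ?_⟩
      rw [stieltjes_neg]
      linear_combination -e
  · rcases lt_abs.1 hl with hl | hl
    · obtain ⟨hm, e⟩ := of_sub_eq_stieltjes hσ hΔ0 hΔσ hl h
      have hl0 : 0 < l := by linarith
      rw [Real.sign_of_pos hl0, Real.sign_of_pos (hb.trans hm), one_mul]
      exact ⟨rfl, e⟩
    · obtain ⟨hm, e⟩ := of_sub_eq_stieltjes hσ hΔ0 hΔσ hl (neg_eq h)
      have hl0 : l < 0 := by linarith
      rw [Real.sign_of_neg hl0, Real.sign_of_neg (by linarith)]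
      refine ⟨rfl, ?_⟩
      rw [neg_sq] at e
      rw [← neg_inj, e]
      ring
end

section
/- Let σ > 0 and let μ be a nonzero real number. Then there exists a real λ with |λ| > 2σ satisfying λ − μ = σ²·𝔤_σ(λ) if and only if |μ| > σ. In that case the solution is unique, satisfies sign(λ) = sign(μ), and equals λ = μ + σ²/μ. -/
theorem sq_mul_stieltjes_of_pos {s l : ℝ} (hs : 0 < s) (hl : 0 < l) :
    s ^ 2 * stieltjes s l = (l - √(l ^ 2 - 4 * s ^ 2)) / 2 := by
  rw [stieltjes, Real.sign_of_pos hl]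
  field_simp

/-- A solution `l > 2 σ` forces `μ > σ` and is given by the explicit formula. -/
theorem eq_add_sq_div_of_sub_eq_stieltjes {σ μ l : ℝ} (hσ : 0 < σ) (hl : 2 * σ < l)
    (h : l - μ = σ ^ 2 * stieltjes σ l) : σ < μ ∧ l = μ + σ ^ 2 / μ := by
  rw [sq_mul_stieltjes_of_pos hσ (show 0 < l by linarith)] at h
  have hr := Real.sqrt_nonneg (l ^ 2 - 4 * σ ^ 2)
  have hr2 := Real.sq_sqrt (show 0 ≤ l ^ 2 - 4 * σ ^ 2 by nlinarith)
  have hμ : σ < μ := by linarith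
  have hsqrt : √(l ^ 2 - 4 * σ ^ 2) = 2 * μ - l := by linarith
  rw [hsqrt] at hr2
  have hμ0 : μ ≠ 0 := by linarith
  refine ⟨hμ, ?_⟩
  field_simp
  linarith

/-- For `μ > σ`, the point `μ + σ² / μ` exceeds `2 σ` and solves the equation. -/
theorem add_sq_div_sub_eq_stieltjes {σ μ : ℝ} (hσ : 0 < σ) (h : σ < μ) :
    2 * σ < μ + σ ^ 2 / μ ∧ μ + σ ^ 2 / μ - μ = σ ^ 2 * stieltjes σ (μ + σ ^ 2 / μ) := by
  have hμ : 0 < μ := hσ.trans h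
  have hgap : μ + σ ^ 2 / μ - 2 * σ = (μ - σ) ^ 2 / μ := by
    field_simp
    ring
  have hpos : 0 < (μ - σ) ^ 2 / μ := div_pos (pow_pos (sub_pos.2 h) 2) hμ
  refine ⟨by linarith, ?_⟩
  have hsq : (μ + σ ^ 2 / μ) ^ 2 - 4 * σ ^ 2 = (μ - σ ^ 2 / μ) ^ 2 := by
    field_simp
    ring
  have hle : σ ^ 2 / μ ≤ μ := by
    rw [div_le_iff₀ hμ]
    nlinarith
  rw [sq_mul_stieltjes_of_pos hσ (show 0 < μ + σ ^ 2 / μ by positivity), hsq, Real.sqrt_sq (sub_nonneg.2 hle)]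
  ring

theorem stmt_2 (σ μ : ℝ) (hσ : 0 < σ) (hμ : μ ≠ 0) :
    ((∃ l : ℝ, 2 * σ < |l| ∧ l - μ = σ ^ 2 * stieltjes σ l) ↔ σ < |μ|) ∧
    (∀ l : ℝ, 2 * σ < |l| → l - μ = σ ^ 2 * stieltjes σ l →
      Real.sign l = Real.sign μ ∧ l = μ + σ ^ 2 / μ) := by
  have key : ∀ l : ℝ, 2 * σ < |l| → l - μ = σ ^ 2 * stieltjes σ l →
      σ < |μ| ∧ Real.sign l = Real.sign μ ∧ l = μ + σ ^ 2 / μ := by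
    intro l hl h
    rcases lt_abs.1 hl with hl | hl
    · obtain ⟨h1, h2⟩ := eq_add_sq_div_of_sub_eq_stieltjes hσ hl h
      refine ⟨lt_abs.2 (Or.inl h1), ?_, h2⟩
      rw [Real.sign_of_pos (by linarith), Real.sign_of_pos (by linarith)]
    · obtain ⟨h1, h2⟩ := eq_add_sq_div_of_sub_eq_stieltjes (μ := -μ) hσ hl
        (by rw [stieltjes_neg]; linarith)
      refine ⟨lt_abs.2 (Or.inr h1), ?_, ?_⟩
      · rw [Real.sign_of_neg (by linarith), Real.sign_of_neg (by linarith)]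
      · rw [div_neg] at h2
        linarith
  refine ⟨⟨fun ⟨l, hl, h⟩ => (key l hl h).1, fun h => ?_⟩, fun l hl h => (key l hl h).2⟩
  rcases lt_abs.1 h with h | h
  · obtain ⟨h1, h2⟩ := add_sq_div_sub_eq_stieltjes hσ h
    exact ⟨_, lt_abs.2 (Or.inl h1), h2⟩
  · obtain ⟨h1, h2⟩ := add_sq_div_sub_eq_stieltjes hσ h
    refine ⟨-(-μ + σ ^ 2 / -μ), lt_abs.2 (Or.inr (by linarith)), ?_⟩
    rw [stieltjes_neg]
    linarith
end

section
/- Let σ > 0, 0 < Δ < σ, set σ̄ = √(σ² − Δ²), and let μ be a real number with |μ| > 2σ̄. Then |𝔤_{σ̄}(μ)| < 1/σ if and only if |μ| > 2σ − Δ²/σ. -/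
theorem abs_stieltjes {s l : ℝ} (hl : l ≠ 0) :
    |stieltjes s l| = (|l| - Real.sqrt (|l| ^ 2 - 4 * s ^ 2)) / (2 * s ^ 2) := by
  have hr : Real.sqrt (l ^ 2 - 4 * s ^ 2) ≤ |l| :=
    Real.sqrt_le_iff.mpr ⟨abs_nonneg l, by rw [sq_abs]; nlinarith [sq_nonneg s]⟩
  rw [stieltjes, abs_div, abs_of_nonneg (by positivity : (0 : ℝ) ≤ 2 * s ^ 2), sq_abs]
  congr 1
  rcases lt_or_gt_of_ne hl with h | h
  · rw [abs_of_neg h] at hr ⊢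
    rw [Real.sign_of_neg h, abs_of_nonpos (by linarith)]
    ring
  · rw [abs_of_pos h] at hr ⊢
    rw [Real.sign_of_pos h, abs_of_nonneg (by linarith)]
    ring

theorem stmt_6 (σ Δ μ σbar : ℝ) (hσ : 0 < σ) (hΔ0 : 0 < Δ) (hΔσ : Δ < σ)
    (hσbar : σbar = Real.sqrt (σ ^ 2 - Δ ^ 2))
    (hμ : 2 * σbar < |μ|) :
    |stieltjes σbar μ| < 1 / σ ↔ 2 * σ - Δ ^ 2 / σ < |μ| := by
  have hsq : 0 < σ ^ 2 - Δ ^ 2 := by nlinarith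
  have hs : 0 < σbar := hσbar ▸ Real.sqrt_pos.mpr hsq
  have hs2 : σbar ^ 2 = σ ^ 2 - Δ ^ 2 := by rw [hσbar, Real.sq_sqrt hsq.le]
  have hsσ : σbar < σ := by nlinarith
  have hμ0 : μ ≠ 0 := by
    rintro rfl
    rw [abs_zero] at hμ
    linarith
  rw [abs_stieltjes hμ0]
  generalize |μ| = m at hμ ⊢
  set c := 2 * σbar ^ 2 / σ with hc
  have hc0 : 0 < c := by positivity
  have hcσ : c * σ = 2 * σbar ^ 2 := by rw [hc]; field_simp
  have hcm : c ≤ m := by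
    have : c ≤ 2 * σbar := by
      rw [hc, div_le_iff₀ hσ]
      nlinarith
    linarith
  have hthreshold : 2 * σ - Δ ^ 2 / σ = σ + c / 2 := by
    rw [hc, hs2]
    field_simp
    ring
  have hscale : 1 / σ * (2 * σbar ^ 2) = c := by rw [hc]; ring
  rw [div_lt_iff₀ (by positivity), hscale, sub_lt_comm, Real.lt_sqrt (by linarith), hthreshold]
  have key : (m - c) ^ 2 - (m ^ 2 - 4 * σbar ^ 2) = 2 * c * (σ + c / 2 - m) := by
    linear_combination (-2) * hcσ
  rw [← sub_neg, key, ← mul_zero (2 * c), mul_lt_mul_iff_right₀ (by positivity), sub_neg]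
end

section
/- Let σ > 0 and let μ be a real number with |μ| > σ. Then the function Δ ↦ (2μσ² − Δ²μ − sign(μ)·Δ²·√(μ² − 4(σ² − Δ²))) / (2(σ² − Δ²)), defined for Δ in the open interval (0, σ), tends to μ + σ²/μ as Δ → σ from the left (i.e. along the filter of neighbourhoods of σ within (0, σ)). -/
theorem stmt_7 (σ μ : ℝ) (hσ : 0 < σ) (hμ : σ < |μ|) :
    Filter.Tendsto (fun Δ : ℝ =>
        (2 * μ * σ ^ 2 - Δ ^ 2 * μ -
            Real.sign μ * Δ ^ 2 * Real.sqrt (μ ^ 2 - 4 * (σ ^ 2 - Δ ^ 2))) /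
          (2 * (σ ^ 2 - Δ ^ 2)))
      (nhdsWithin σ (Set.Ioo 0 σ)) (nhds (μ + σ ^ 2 / μ)) := by
  have hμ0 : μ ≠ 0 := abs_pos.mp (hσ.trans hμ)
  have hsign : Real.sign μ * |μ| = μ := by
    rcases lt_or_gt_of_ne hμ0 with h | h
    · simp [Real.sign_of_neg h, abs_of_neg h]
    · simp [Real.sign_of_pos h, abs_of_pos h]
  have hsq : Real.sign μ ^ 2 = 1 := by
    rcases Real.sign_apply_eq_of_ne_zero μ hμ0 with h | h <;> simp [h]
  -- Rationalising the numerator removes the singularity at `Δ = σ`.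
  have hlim : Filter.Tendsto
      (fun Δ : ℝ => μ + 2 * Δ ^ 2 /
        (μ + Real.sign μ * Real.sqrt (μ ^ 2 - 4 * (σ ^ 2 - Δ ^ 2))))
      (nhds σ) (nhds (μ + σ ^ 2 / μ)) := by
    have hval : Real.sign μ * Real.sqrt (μ ^ 2 - 4 * (σ ^ 2 - σ ^ 2)) = μ := by
      simp [Real.sqrt_sq_eq_abs, hsign]
    have hcont : ContinuousAt
        (fun Δ : ℝ => μ + 2 * Δ ^ 2 /
          (μ + Real.sign μ * Real.sqrt (μ ^ 2 - 4 * (σ ^ 2 - Δ ^ 2)))) σ := by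
      refine continuousAt_const.add (ContinuousAt.div (by fun_prop) (by fun_prop) ?_)
      rw [hval, ← two_mul]
      exact mul_ne_zero two_ne_zero hμ0
    convert hcont.tendsto using 2
    rw [hval]
    field_simp
    ring
  have hpos : ∀ᶠ Δ : ℝ in nhds σ, 0 < μ ^ 2 - 4 * (σ ^ 2 - Δ ^ 2) := by
    have hcont : ContinuousAt (fun Δ : ℝ => μ ^ 2 - 4 * (σ ^ 2 - Δ ^ 2)) σ := by fun_prop
    refine hcont.eventually_const_lt ?_
    simpa using pow_pos (abs_pos.mpr hμ0) 2
  refine (hlim.mono_left nhdsWithin_le_nhds).congr' ?_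
  filter_upwards [self_mem_nhdsWithin, nhdsWithin_le_nhds hpos] with Δ hΔ hrad
  have hgap : σ ^ 2 - Δ ^ 2 ≠ 0 := by nlinarith [hΔ.1, hΔ.2]
  have hroot := Real.sq_sqrt hrad.le
  have hroot0 := Real.sqrt_nonneg (μ ^ 2 - 4 * (σ ^ 2 - Δ ^ 2))
  set r := Real.sqrt (μ ^ 2 - 4 * (σ ^ 2 - Δ ^ 2))
  have hden : μ + Real.sign μ * r ≠ 0 := by
    have hfactor : μ + Real.sign μ * r = Real.sign μ * (|μ| + r) := by
      rw [mul_add, hsign]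
    rw [hfactor]
    refine mul_ne_zero (fun h => by simp [h] at hsq) ?_
    linarith
  rw [← sub_eq_zero]
  field_simp
  linear_combination Δ ^ 2 * Real.sign μ ^ 2 * hroot +
    Δ ^ 2 * (μ ^ 2 - 4 * (σ ^ 2 - Δ ^ 2)) * hsq
end

section
/- Let σ, Δ > 0 and let μ be a nonzero real number with μ² − 4(σ² − Δ²) > 0. Let λ be a real number with |λ| > 2σ, sign(λ) = sign(μ), and λ − μ = Δ²·𝔤_σ(λ). Then 2|μ|σ² > |λ|·(2σ² − Δ²), and consequently 𝔮_{σ,Δ}(λ, μ) > 0. -/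
/-- The squared projection `𝔮_{σ,Δ}(l, μ)` of the outlier eigenvector on the special
    direction. -/
noncomputable def qProj (σ Δ l μ : ℝ) : ℝ :=
  Real.sign μ *
    (Real.sign l * Δ ^ 2 * Real.sqrt (l ^ 2 - 4 * σ ^ 2) - l * (2 * σ ^ 2 - Δ ^ 2) +
      2 * μ * σ ^ 2) /
    (2 * Δ ^ 2 * Real.sqrt (μ ^ 2 - 4 * (σ ^ 2 - Δ ^ 2)))

theorem stmt_9 (σ Δ μ l : ℝ) (hσ : 0 < σ) (hΔ : 0 < Δ) (hμ : μ ≠ 0)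
    (hdisc : 0 < μ ^ 2 - 4 * (σ ^ 2 - Δ ^ 2))
    (hl : 2 * σ < |l|) (hsign : Real.sign l = Real.sign μ)
    (heq : l - μ = Δ ^ 2 * stieltjes σ l) :
    |l| * (2 * σ ^ 2 - Δ ^ 2) < 2 * |μ| * σ ^ 2 ∧ 0 < qProj σ Δ l μ := by
  have hr : 0 < Real.sqrt (l ^ 2 - 4 * σ ^ 2) := by
    apply Real.sqrt_pos.mpr
    nlinarith [sq_abs l]
  have hd : 0 < Real.sqrt (μ ^ 2 - 4 * (σ ^ 2 - Δ ^ 2)) := Real.sqrt_pos.mpr hdisc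
  have hΔr : 0 < Δ ^ 2 * Real.sqrt (l ^ 2 - 4 * σ ^ 2) := by positivity
  have hclear : (l - μ) * (2 * σ ^ 2) =
      Δ ^ 2 * (l - Real.sign l * Real.sqrt (l ^ 2 - 4 * σ ^ 2)) := by
    rw [heq, stieltjes]
    field_simp
  have habs (x : ℝ) : Real.sign x * x = |x| := by
    rcases lt_trichotomy x 0 with h | h | h
    · rw [Real.sign_of_neg h, abs_of_neg h]; ring
    · simp [h]
    · rw [Real.sign_of_pos h, abs_of_pos h]; ring
  have hsq : Real.sign μ * Real.sign μ = 1 := by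
    rcases Real.sign_apply_eq_of_ne_zero μ hμ with h | h <;> rw [h] <;> norm_num
  have hla : Real.sign μ * l = |l| := hsign ▸ habs l
  have hμa : Real.sign μ * μ = |μ| := habs μ
  rw [hsign] at hclear
  have hmain : 2 * |μ| * σ ^ 2 =
      |l| * (2 * σ ^ 2 - Δ ^ 2) + Δ ^ 2 * Real.sqrt (l ^ 2 - 4 * σ ^ 2) := by
    rw [← hla, ← hμa]
    linear_combination (-Real.sign μ) * hclear +
      Δ ^ 2 * Real.sqrt (l ^ 2 - 4 * σ ^ 2) * hsq
  refine ⟨by linarith, ?_⟩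
  rw [qProj, hsign]
  refine div_pos ?_ (by positivity)
  have hnum : Real.sign μ *
      (Real.sign μ * Δ ^ 2 * Real.sqrt (l ^ 2 - 4 * σ ^ 2) - l * (2 * σ ^ 2 - Δ ^ 2) +
        2 * μ * σ ^ 2) = 2 * (Δ ^ 2 * Real.sqrt (l ^ 2 - 4 * σ ^ 2)) := by
    linear_combination Δ ^ 2 * Real.sqrt (l ^ 2 - 4 * σ ^ 2) * hsq -
      (2 * σ ^ 2 - Δ ^ 2) * hla + 2 * σ ^ 2 * hμa + hmain
  rw [hnum]
  positivity
end

section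
/- Let σ, Δ > 0 and let μ be a nonzero real number with μ² − 4(σ² − Δ²) > 0. Let λ be a real number with |λ| > 2σ, sign(λ) = sign(μ), and λ − μ = Δ²·𝔤_σ(λ). Then the derivative at λ of the function t ↦ t − μ − Δ²·𝔤_σ(t) equals the reciprocal of 𝔮_{σ,Δ}(λ, μ); that is, (1 − Δ²·𝔤_σ′(λ)) · 𝔮_{σ,Δ}(λ, μ) = 1, where 𝔤_σ′(λ) denotes the derivative of 𝔤_σ at λ. -/
/-- The sign function is locally constant away from the origin. -/
theorem Real.eventually_sign_eq {l : ℝ} (hl : l ≠ 0) :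
    ∀ᶠ t in nhds l, Real.sign t = Real.sign l := by
  rcases hl.lt_or_gt with h | h
  · filter_upwards [eventually_lt_nhds h] with t ht
    rw [Real.sign_of_neg ht, Real.sign_of_neg h]
  · filter_upwards [eventually_gt_nhds h] with t ht
    rw [Real.sign_of_pos ht, Real.sign_of_pos h]

theorem four_mul_sq_lt_sq {s l : ℝ} (hs : 0 < s) (hl : 2 * s < |l|) : 0 < l ^ 2 - 4 * s ^ 2 := by
  nlinarith [sq_abs l]

/-- Outside the bulk, `𝔤_s'(l) = -𝔤_s(l) / (sign(l) * √(l² - 4 s²))`. -/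
theorem hasDerivAt_stieltjes {s l : ℝ} (hs : 0 < s) (hl : 2 * s < |l|) :
    HasDerivAt (stieltjes s)
      (-stieltjes s l / (Real.sign l * Real.sqrt (l ^ 2 - 4 * s ^ 2))) l := by
  have hpos := four_mul_sq_lt_sq hs hl
  have hl0 : l ≠ 0 := abs_pos.mp (by linarith)
  have hr := Real.sqrt_pos.mpr hpos
  have hd : HasDerivAt (fun t : ℝ => t ^ 2 - 4 * s ^ 2) (2 * l) l := by
    simpa using (hasDerivAt_pow 2 l).sub_const (4 * s ^ 2)
  have h := ((hasDerivAt_id l).sub ((hd.sqrt hpos.ne').const_mul (Real.sign l))).div_const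
    (2 * s ^ 2)
  refine (h.congr_deriv ?_).congr_of_eventuallyEq ?_
  · rcases Real.sign_apply_eq_of_ne_zero l hl0 with he | he <;>
    · simp only [stieltjes, he]
      field_simp
      ring
  · filter_upwards [Real.eventually_sign_eq hl0] with t ht
    simp [stieltjes, ht]

/-- Outside the bulk, `𝔤_s(l)` has the sign of `l`. -/
theorem sign_mul_stieltjes_pos {s l : ℝ} (hs : 0 < s) (hl : 2 * s < |l|) :
    0 < Real.sign l * stieltjes s l := by
  have hlt : Real.sqrt (l ^ 2 - 4 * s ^ 2) < |l| :=
    (Real.sqrt_lt' (by linarith)).mpr (by rw [sq_abs]; linarith [pow_pos hs 2])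
  have hl0 : l ≠ 0 := abs_pos.mp (by linarith)
  have hs2 : 0 < 2 * s ^ 2 := by positivity
  rw [stieltjes, ← mul_div_assoc]
  refine div_pos ?_ hs2
  rcases hl0.lt_or_gt with h | h
  · rw [Real.sign_of_neg h]
    rw [abs_of_neg h] at hlt
    linarith
  · rw [Real.sign_of_pos h]
    rw [abs_of_pos h] at hlt
    linarith

theorem stmt_11 (σ Δ μ l : ℝ) (hσ : 0 < σ) (hΔ : 0 < Δ) (hμ : μ ≠ 0)
    (hdisc : 0 < μ ^ 2 - 4 * (σ ^ 2 - Δ ^ 2))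
    (hl : 2 * σ < |l|) (hsign : Real.sign l = Real.sign μ)
    (heq : l - μ = Δ ^ 2 * stieltjes σ l) :
    deriv (fun t => t - μ - Δ ^ 2 * stieltjes σ t) l = (qProj σ Δ l μ)⁻¹ ∧
    (1 - Δ ^ 2 * deriv (stieltjes σ) l) * qProj σ Δ l μ = 1 := by
  have hpos := four_mul_sq_lt_sq hσ hl
  have hl0 : l ≠ 0 := abs_pos.mp (by linarith)
  have hg := hasDerivAt_stieltjes hσ hl
  have hgpos := sign_mul_stieltjes_pos hσ hl
  have hr := Real.sqrt_pos.mpr hpos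
  have hr2 := Real.sq_sqrt hpos.le
  have hgdef : 2 * σ ^ 2 * stieltjes σ l =
      l - Real.sign l * Real.sqrt (l ^ 2 - 4 * σ ^ 2) := by
    rw [stieltjes]
    field_simp
  have he2 : Real.sign l ^ 2 = 1 := by
    rcases Real.sign_apply_eq_of_ne_zero l hl0 with he | he <;> rw [he] <;> norm_num
  have he0 : Real.sign l ≠ 0 := fun h => by simp [h] at he2
  rw [qProj, ← hsign]
  set g := stieltjes σ l
  set r := Real.sqrt (l ^ 2 - 4 * σ ^ 2)
  set e := Real.sign l
  obtain rfl : μ = l - Δ ^ 2 * g := by linarith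
  have hquad : σ ^ 2 * g ^ 2 - l * g + 1 = 0 := by
    have h : 4 * σ ^ 2 * (σ ^ 2 * g ^ 2 - l * g + 1) = 0 := by
      linear_combination (2 * σ ^ 2 * g - l - e * r) * hgdef + r ^ 2 * he2 + hr2
    exact (mul_eq_zero.mp h).resolve_left (by positivity)
  have hVpos : 0 < r + Δ ^ 2 * (e * g) := by positivity
  have hV : Real.sqrt ((l - Δ ^ 2 * g) ^ 2 - 4 * (σ ^ 2 - Δ ^ 2)) = r + Δ ^ 2 * (e * g) := by
    rw [Real.sqrt_eq_iff_mul_self_eq_of_pos hVpos]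
    linear_combination hr2 + Δ ^ 4 * g ^ 2 * he2 + 2 * Δ ^ 2 * g * hgdef - 4 * Δ ^ 2 * hquad
  have hnum : e * (e * Δ ^ 2 * r - l * (2 * σ ^ 2 - Δ ^ 2) + 2 * (l - Δ ^ 2 * g) * σ ^ 2) =
      2 * Δ ^ 2 * r := by
    linear_combination 2 * Δ ^ 2 * r * he2 - e * Δ ^ 2 * hgdef
  have hmain : (1 - Δ ^ 2 * deriv (stieltjes σ) l) *
      (e * (e * Δ ^ 2 * r - l * (2 * σ ^ 2 - Δ ^ 2) + 2 * (l - Δ ^ 2 * g) * σ ^ 2) /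
        (2 * Δ ^ 2 * Real.sqrt ((l - Δ ^ 2 * g) ^ 2 - 4 * (σ ^ 2 - Δ ^ 2)))) = 1 := by
    have hderiv : 1 - Δ ^ 2 * (-g / (e * r)) = (r + Δ ^ 2 * (e * g)) / r := by
      field_simp
      linear_combination -Δ ^ 2 * g * he2
    rw [hg.deriv, hnum, hV, hderiv, mul_div_mul_left _ _ (by positivity),
      div_mul_div_cancel₀ hr.ne', div_self hVpos.ne']
  refine ⟨?_, hmain⟩
  rw [← eq_inv_of_mul_eq_one_left hmain, hg.deriv]
  exact (((hasDerivAt_id l).sub_const _).sub (hg.const_mul _)).deriv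
end

section
/- Let σ_H, σ_W > 0 and set σ = √(σ_H² + σ_W²). Then for every real z > 2σ one has z − σ_W²·𝔤_σ(z) > 2σ_H, and the subordination identity 𝔤_{σ_H}(z − σ_W²·𝔤_σ(z)) = 𝔤_σ(z) holds. -/
theorem two_mul_lt_of_mul_lt_one {s g : ℝ} (hg : 0 < g) (hsg : s * g < 1) :
    2 * s < s ^ 2 * g + 1 / g := by
  have h : s ^ 2 * g + 1 / g - 2 * s = (1 - s * g) ^ 2 / g := by
    field_simp
    ring
  have : 0 < (1 - s * g) ^ 2 / g := div_pos (pow_pos (sub_pos.2 hsg) 2) hg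
  linarith

theorem stieltjes_eq_of_mul_lt_one {s g : ℝ} (hs : 0 < s) (hg : 0 < g) (hsg : s * g < 1) :
    stieltjes s (s ^ 2 * g + 1 / g) = g := by
  have hpos : 0 < s ^ 2 * g + 1 / g := by positivity
  have hsq : (s ^ 2 * g + 1 / g) ^ 2 - 4 * s ^ 2 = (1 / g - s ^ 2 * g) ^ 2 := by
    field_simp
    ring
  have hnonneg : 0 ≤ 1 / g - s ^ 2 * g := by
    rw [sub_nonneg, le_div_iff₀ hg]
    nlinarith [mul_pos hs hg]
  rw [stieltjes, Real.sign_of_pos hpos, hsq, Real.sqrt_sq hnonneg]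
  field_simp
  ring

theorem exists_eq_sq_mul_add_one_div {s z : ℝ} (hs : 0 < s) (hz : 2 * s < z) :
    ∃ g, 0 < g ∧ s * g < 1 ∧ z = s ^ 2 * g + 1 / g := by
  have hr : Real.sqrt (z ^ 2 - 4 * s ^ 2) ^ 2 = z ^ 2 - 4 * s ^ 2 :=
    Real.sq_sqrt (by nlinarith)
  have hlt : Real.sqrt (z ^ 2 - 4 * s ^ 2) < z :=
    (Real.sqrt_lt' (by linarith)).2 (by nlinarith)
  have hgt : z - 2 * s < Real.sqrt (z ^ 2 - 4 * s ^ 2) :=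
    Real.lt_sqrt_of_sq_lt (by nlinarith)
  set r := Real.sqrt (z ^ 2 - 4 * s ^ 2)
  have hzr : z - r ≠ 0 := (sub_pos.2 hlt).ne'
  refine ⟨(z - r) / (2 * s ^ 2), div_pos (sub_pos.2 hlt) (by positivity), ?_, ?_⟩
  · rw [← mul_div_assoc, div_lt_one (by positivity)]
    nlinarith
  · field_simp
    linarith

theorem stmt_12 (σH σW σ : ℝ) (hσH : 0 < σH) (hσW : 0 < σW)
    (hσ : σ = Real.sqrt (σH ^ 2 + σW ^ 2)) :
    ∀ z : ℝ, 2 * σ < z →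
      2 * σH < z - σW ^ 2 * stieltjes σ z ∧
      stieltjes σH (z - σW ^ 2 * stieltjes σ z) = stieltjes σ z := by
  intro z hz
  have hσpos : 0 < σ := by rw [hσ]; positivity
  have hσsq : σ ^ 2 = σH ^ 2 + σW ^ 2 := by rw [hσ]; exact Real.sq_sqrt (by positivity)
  have hle : σH ≤ σ := by rw [hσ]; exact Real.le_sqrt_of_sq_le (by nlinarith)
  obtain ⟨g, hg, hσg, rfl⟩ := exists_eq_sq_mul_add_one_div hσpos hz
  have hHg : σH * g < 1 := (mul_le_mul_of_nonneg_right hle hg.le).trans_lt hσg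
  have hw : σ ^ 2 * g + 1 / g - σW ^ 2 * g = σH ^ 2 * g + 1 / g := by rw [hσsq]; ring
  rw [stieltjes_eq_of_mul_lt_one hσpos hg hσg, hw]
  exact ⟨two_mul_lt_of_mul_lt_one hg hHg, stieltjes_eq_of_mul_lt_one hσH hg hHg⟩
end

section
/- Let σ > 0 and let x be a real number with 0 < |x| < 2σ. Then, using the principal branch of the complex square root: (i) the limit as η → 0⁺ of √((x − iη)² − 4σ²) equals −i·sign(x)·√(4σ² − x²), and the limit as η → 0⁺ of √((x + iη)² − 4σ²) equals +i·sign(x)·√(4σ² − x²); (ii) consequently the limit as η → 0⁺ of the imaginary part of ((x − iη) − sign(x)·√((x − iη)² − 4σ²)) / (2σ²) equals √(4σ² − x²)/(2σ²), i.e. π times the semicircle density ρ_σ(x) = √(4σ² − x²)/(2πσ²). Moreover for |x| > 2σ the limit as η → 0⁺ of √((x ± iη)² − 4σ²) equals the real number √(x² − 4σ²). -/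
open Complex

/-- The principal branch of the complex square root (branch cut along the negative
    real axis, arguments in `(-π, π]`). -/
noncomputable def csqrt (z : ℂ) : ℂ := z ^ (1 / 2 : ℂ)

lemma csqrt_ofReal {a : ℝ} (ha : 0 ≤ a) : csqrt (a : ℂ) = (Real.sqrt a : ℂ) := by
  rw [csqrt, Real.sqrt_eq_rpow, Complex.ofReal_cpow ha]
  norm_num

lemma exp_half_pi_mul_I : Complex.exp (Real.pi * I * (1 / 2)) = I := by
  convert Complex.exp_pi_div_two_mul_I using 2
  ring

lemma csqrt_neg_of_im_neg {z : ℂ} (hz : z.im < 0) : csqrt (-z) = I * csqrt z := by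
  have h0 : z ≠ 0 := by
    rintro rfl
    simp at hz
  have hlog : Complex.log (-z) = Complex.log z + Real.pi * I := by
    simp only [Complex.log, norm_neg, Complex.arg_neg_eq_arg_add_pi_of_im_neg hz]
    push_cast
    ring
  rw [csqrt, csqrt, Complex.cpow_def_of_ne_zero (neg_ne_zero.mpr h0),
    Complex.cpow_def_of_ne_zero h0, hlog, add_mul, Complex.exp_add, exp_half_pi_mul_I, mul_comm]

lemma csqrt_of_im_neg {z : ℂ} (hz : z.im < 0) : csqrt z = -I * csqrt (-z) := by
  rw [csqrt_neg_of_im_neg hz, ← mul_assoc]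
  simp

lemma csqrt_of_im_pos {z : ℂ} (hz : 0 < z.im) : csqrt z = I * csqrt (-z) := by
  simpa using csqrt_neg_of_im_neg (z := -z) (by simpa using hz)

lemma tendsto_csqrt_of_pos {α : Type*} {l : Filter α} {f : α → ℂ} {a : ℝ} (ha : 0 < a)
    (hf : Filter.Tendsto f l (nhds (a : ℂ))) :
    Filter.Tendsto (fun t => csqrt (f t)) l (nhds (Real.sqrt a : ℂ)) := by
  rw [← csqrt_ofReal ha.le]
  exact (continuousAt_cpow_const (Complex.ofReal_mem_slitPlane.mpr ha)).tendsto.comp hf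

lemma tendsto_csqrt_of_im_neg {α : Type*} {l : Filter α} {f : α → ℂ} {a : ℝ} (ha : a < 0)
    (hf : Filter.Tendsto f l (nhds (a : ℂ))) (him : ∀ᶠ t in l, (f t).im < 0) :
    Filter.Tendsto (fun t => csqrt (f t)) l (nhds (-I * (Real.sqrt (-a) : ℂ))) := by
  have hneg : Filter.Tendsto (fun t => -f t) l (nhds ((-a : ℝ) : ℂ)) := by
    rw [Complex.ofReal_neg]
    exact hf.neg
  have h := tendsto_csqrt_of_pos (neg_pos.mpr ha) hneg
  refine (h.const_mul (-I)).congr' ?_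
  filter_upwards [him] with t ht
  exact (csqrt_of_im_neg ht).symm

lemma tendsto_csqrt_of_im_pos {α : Type*} {l : Filter α} {f : α → ℂ} {a : ℝ} (ha : a < 0)
    (hf : Filter.Tendsto f l (nhds (a : ℂ))) (him : ∀ᶠ t in l, 0 < (f t).im) :
    Filter.Tendsto (fun t => csqrt (f t)) l (nhds (I * (Real.sqrt (-a) : ℂ))) := by
  have hneg : Filter.Tendsto (fun t => -f t) l (nhds ((-a : ℝ) : ℂ)) := by
    rw [Complex.ofReal_neg]
    exact hf.neg
  have h := tendsto_csqrt_of_pos (neg_pos.mpr ha) hneg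
  refine (h.const_mul I).congr' ?_
  filter_upwards [him] with t ht
  exact (csqrt_of_im_pos ht).symm

lemma tendsto_sub_mul_I_sq_sub (x c : ℝ) :
    Filter.Tendsto (fun η : ℝ => ((x : ℂ) - (η : ℂ) * I) ^ 2 - (c : ℂ))
      (nhdsWithin 0 (Set.Ioi 0)) (nhds ((x ^ 2 - c : ℝ) : ℂ)) := by
  have h : Continuous fun η : ℝ => ((x : ℂ) - (η : ℂ) * I) ^ 2 - (c : ℂ) := by fun_prop
  simpa using (h.tendsto 0).mono_left nhdsWithin_le_nhds

lemma tendsto_add_mul_I_sq_sub (x c : ℝ) :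
    Filter.Tendsto (fun η : ℝ => ((x : ℂ) + (η : ℂ) * I) ^ 2 - (c : ℂ))
      (nhdsWithin 0 (Set.Ioi 0)) (nhds ((x ^ 2 - c : ℝ) : ℂ)) := by
  have h : Continuous fun η : ℝ => ((x : ℂ) + (η : ℂ) * I) ^ 2 - (c : ℂ) := by fun_prop
  simpa using (h.tendsto 0).mono_left nhdsWithin_le_nhds

lemma im_sub_mul_I_sq_sub (x c η : ℝ) :
    (((x : ℂ) - (η : ℂ) * I) ^ 2 - (c : ℂ)).im = -(2 * x * η) := by
  simp [pow_two]
  ring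

lemma im_add_mul_I_sq_sub (x c η : ℝ) :
    (((x : ℂ) + (η : ℂ) * I) ^ 2 - (c : ℂ)).im = 2 * x * η := by
  simp [pow_two]
  ring

lemma tendsto_csqrt_sub_mul_I {x c : ℝ} (hx : x ≠ 0) (hc : x ^ 2 < c) :
    Filter.Tendsto (fun η : ℝ => csqrt (((x : ℂ) - (η : ℂ) * I) ^ 2 - (c : ℂ)))
      (nhdsWithin 0 (Set.Ioi 0))
      (nhds (-I * ((Real.sign x : ℝ) : ℂ) * (Real.sqrt (c - x ^ 2) : ℂ))) := by
  have ha : x ^ 2 - c < 0 := sub_neg.mpr hc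
  rcases hx.lt_or_gt with h | h
  · have := tendsto_csqrt_of_im_pos ha (tendsto_sub_mul_I_sq_sub x c) (by
      filter_upwards [self_mem_nhdsWithin] with η (hη : 0 < η)
      rw [im_sub_mul_I_sq_sub]
      nlinarith [mul_pos (neg_pos.mpr h) hη])
    simpa [Real.sign_of_neg h] using this
  · have := tendsto_csqrt_of_im_neg ha (tendsto_sub_mul_I_sq_sub x c) (by
      filter_upwards [self_mem_nhdsWithin] with η (hη : 0 < η)
      rw [im_sub_mul_I_sq_sub]
      nlinarith [mul_pos h hη])
    simpa [Real.sign_of_pos h] using this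

lemma tendsto_csqrt_add_mul_I {x c : ℝ} (hx : x ≠ 0) (hc : x ^ 2 < c) :
    Filter.Tendsto (fun η : ℝ => csqrt (((x : ℂ) + (η : ℂ) * I) ^ 2 - (c : ℂ)))
      (nhdsWithin 0 (Set.Ioi 0))
      (nhds (I * ((Real.sign x : ℝ) : ℂ) * (Real.sqrt (c - x ^ 2) : ℂ))) := by
  have ha : x ^ 2 - c < 0 := sub_neg.mpr hc
  rcases hx.lt_or_gt with h | h
  · have := tendsto_csqrt_of_im_neg ha (tendsto_add_mul_I_sq_sub x c) (by
      filter_upwards [self_mem_nhdsWithin] with η (hη : 0 < η)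
      rw [im_add_mul_I_sq_sub]
      nlinarith [mul_pos (neg_pos.mpr h) hη])
    simpa [Real.sign_of_neg h] using this
  · have := tendsto_csqrt_of_im_pos ha (tendsto_add_mul_I_sq_sub x c) (by
      filter_upwards [self_mem_nhdsWithin] with η (hη : 0 < η)
      rw [im_add_mul_I_sq_sub]
      nlinarith [mul_pos h hη])
    simpa [Real.sign_of_pos h] using this

theorem stmt_16 (σ x : ℝ) (hσ : 0 < σ) (hx0 : 0 < |x|) (hx : |x| < 2 * σ) :
    (Filter.Tendsto
        (fun η : ℝ => csqrt ((((x : ℂ) - (η : ℂ) * Complex.I)) ^ 2 - ((4 * σ ^ 2 : ℝ) : ℂ)))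
        (nhdsWithin 0 (Set.Ioi 0))
        (nhds (-Complex.I * ((Real.sign x : ℝ) : ℂ) * ((Real.sqrt (4 * σ ^ 2 - x ^ 2) : ℝ) : ℂ))) ∧
      Filter.Tendsto
        (fun η : ℝ => csqrt ((((x : ℂ) + (η : ℂ) * Complex.I)) ^ 2 - ((4 * σ ^ 2 : ℝ) : ℂ)))
        (nhdsWithin 0 (Set.Ioi 0))
        (nhds (Complex.I * ((Real.sign x : ℝ) : ℂ) * ((Real.sqrt (4 * σ ^ 2 - x ^ 2) : ℝ) : ℂ)))) ∧
    (Filter.Tendsto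
        (fun η : ℝ =>
          ((((x : ℂ) - (η : ℂ) * Complex.I) -
              ((Real.sign x : ℝ) : ℂ) *
                csqrt ((((x : ℂ) - (η : ℂ) * Complex.I)) ^ 2 - ((4 * σ ^ 2 : ℝ) : ℂ))) /
            ((2 * σ ^ 2 : ℝ) : ℂ)).im)
        (nhdsWithin 0 (Set.Ioi 0))
        (nhds (Real.sqrt (4 * σ ^ 2 - x ^ 2) / (2 * σ ^ 2))) ∧
      Real.sqrt (4 * σ ^ 2 - x ^ 2) / (2 * σ ^ 2)
        = Real.pi * (Real.sqrt (4 * σ ^ 2 - x ^ 2) / (2 * Real.pi * σ ^ 2))) ∧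
    (∀ x' : ℝ, 2 * σ < |x'| →
      Filter.Tendsto
        (fun η : ℝ => csqrt ((((x' : ℂ) - (η : ℂ) * Complex.I)) ^ 2 - ((4 * σ ^ 2 : ℝ) : ℂ)))
        (nhdsWithin 0 (Set.Ioi 0))
        (nhds ((Real.sqrt (x' ^ 2 - 4 * σ ^ 2) : ℝ) : ℂ)) ∧
      Filter.Tendsto
        (fun η : ℝ => csqrt ((((x' : ℂ) + (η : ℂ) * Complex.I)) ^ 2 - ((4 * σ ^ 2 : ℝ) : ℂ)))
        (nhdsWithin 0 (Set.Ioi 0))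
        (nhds ((Real.sqrt (x' ^ 2 - 4 * σ ^ 2) : ℝ) : ℂ))) := by
  have hxne : x ≠ 0 := abs_pos.mp hx0
  have hc : x ^ 2 < 4 * σ ^ 2 := by
    rw [← sq_abs]
    nlinarith
  have hsub := tendsto_csqrt_sub_mul_I hxne hc
  refine ⟨⟨hsub, tendsto_csqrt_add_mul_I hxne hc⟩, ⟨?_, ?_⟩, fun x' hx' => ?_⟩
  · have hline : Filter.Tendsto (fun η : ℝ => (x : ℂ) - (η : ℂ) * I)
        (nhdsWithin 0 (Set.Ioi 0)) (nhds (x : ℂ)) := by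
      have h : Continuous fun η : ℝ => (x : ℂ) - (η : ℂ) * I := by fun_prop
      simpa using (h.tendsto 0).mono_left nhdsWithin_le_nhds
    have hlim := (Complex.continuous_im.tendsto _).comp
      ((hline.sub (hsub.const_mul ((Real.sign x : ℝ) : ℂ))).div_const ((2 * σ ^ 2 : ℝ) : ℂ))
    have hsign : Real.sign x * Real.sign x = 1 := by
      rcases hxne.lt_or_gt with h | h
      · simp [Real.sign_of_neg h]
      · simp [Real.sign_of_pos h]
    have him : Real.sqrt (4 * σ ^ 2 - x ^ 2) / (2 * σ ^ 2) =
        (((x : ℂ) - ((Real.sign x : ℝ) : ℂ) * (-I * ((Real.sign x : ℝ) : ℂ) *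
          (Real.sqrt (4 * σ ^ 2 - x ^ 2) : ℂ))) / ((2 * σ ^ 2 : ℝ) : ℂ)).im := by
      rw [Complex.div_ofReal_im]
      simp [← mul_assoc, hsign]
    rw [him]
    exact hlim
  · field_simp
  · have hpos : 0 < x' ^ 2 - 4 * σ ^ 2 := by
      rw [← sq_abs x']
      nlinarith
    exact ⟨tendsto_csqrt_of_pos hpos (tendsto_sub_mul_I_sq_sub x' _),
      tendsto_csqrt_of_pos hpos (tendsto_add_mul_I_sq_sub x' _)⟩
end

section
/- Let σ > 0 and σ_W ≥ 0, and let z be a real number with z > 2σ. Then the function ξ ↦ (𝔤_σ(z) − 𝔤_σ(ξ)) / (ξ − z − σ_W²·(𝔤_σ(ξ) − 𝔤_σ(z))), defined for ξ in (2σ, ∞) with ξ ≠ z, tends to 𝔤_σ(z) / (z + (σ_W² − 2σ²)·𝔤_σ(z)) as ξ → z; moreover the denominator z + (σ_W² − 2σ²)·𝔤_σ(z) is strictly positive. -/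
theorem stieltjes_of_pos {s l : ℝ} (hl : 0 < l) :
    stieltjes s l = (l - √(l ^ 2 - 4 * s ^ 2)) / (2 * s ^ 2) := by
  rw [stieltjes, Real.sign_of_pos hl, one_mul]

theorem sub_two_mul_stieltjes {s l : ℝ} (hs : 0 < s) (hl : 0 < l) :
    l - 2 * s ^ 2 * stieltjes s l = √(l ^ 2 - 4 * s ^ 2) := by
  rw [stieltjes_of_pos hl]
  field_simp
  ring

theorem stieltjes_pos {s l : ℝ} (hs : 0 < s) (hl : 2 * s < l) : 0 < stieltjes s l := by
  have hl0 : 0 < l := by linarith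
  rw [stieltjes_of_pos hl0]
  have h : √(l ^ 2 - 4 * s ^ 2) < l := by
    rw [Real.sqrt_lt' hl0]
    nlinarith
  exact div_pos (sub_pos.2 h) (by positivity)

/-- The quadratic equation satisfied by the Stieltjes transform of the semicircle law. -/
theorem stieltjes_quadratic {s l : ℝ} (hs : 0 < s) (hl : 2 * s < l) :
    s ^ 2 * stieltjes s l ^ 2 - l * stieltjes s l + 1 = 0 := by
  have h := Real.sq_sqrt (show 0 ≤ l ^ 2 - 4 * s ^ 2 by nlinarith)
  rw [← sub_two_mul_stieltjes hs (by linarith)] at h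
  have h4 : 4 * s ^ 2 ≠ 0 := by positivity
  exact mul_left_cancel₀ h4 (by linear_combination h)

theorem continuousAt_stieltjes {s l : ℝ} (hl : 0 < l) : ContinuousAt (stieltjes s) l := by
  have h : ContinuousAt (fun x : ℝ => (x - √(x ^ 2 - 4 * s ^ 2)) / (2 * s ^ 2)) l := by
    fun_prop
  refine h.congr ?_
  filter_upwards [lt_mem_nhds hl] with x hx
  exact (stieltjes_of_pos hx).symm

theorem stieltjes_sub_div_eq {s c z x : ℝ} (hs : 0 < s) (hz : 2 * s < z) (hx : 2 * s < x)
    (hxz : x ≠ z) :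
    (stieltjes s z - stieltjes s x) / (x - z - c * (stieltjes s x - stieltjes s z)) =
      stieltjes s x / (z - s ^ 2 * (stieltjes s z + stieltjes s x) + c * stieltjes s x) := by
  have hqz := stieltjes_quadratic hs hz
  have hqx := stieltjes_quadratic hs hx
  have hpos := stieltjes_pos hs hx
  set a := stieltjes s z
  set b := stieltjes s x
  have hd : x - z ≠ 0 := sub_ne_zero.2 hxz
  have key : (z - s ^ 2 * (a + b)) * (a - b) = (x - z) * b := by
    linear_combination hqx - hqz
  have hN : z - s ^ 2 * (a + b) ≠ 0 := by
    intro h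
    rw [h, zero_mul] at key
    exact mul_ne_zero hd hpos.ne' key.symm
  rw [← mul_div_mul_left _ _ hN, key, ← mul_div_mul_left b _ hd]
  congr 1
  linear_combination c * key

theorem stmt_17 (σ σW z : ℝ) (hσ : 0 < σ) (hσW : 0 ≤ σW) (hz : 2 * σ < z) :
    Filter.Tendsto (fun ξ : ℝ =>
        (stieltjes σ z - stieltjes σ ξ) /
          (ξ - z - σW ^ 2 * (stieltjes σ ξ - stieltjes σ z)))
      (nhdsWithin z (Set.Ioi (2 * σ) \ {z}))
      (nhds (stieltjes σ z / (z + (σW ^ 2 - 2 * σ ^ 2) * stieltjes σ z))) ∧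
    0 < z + (σW ^ 2 - 2 * σ ^ 2) * stieltjes σ z := by
  have hz0 : 0 < z := by linarith
  have hden : 0 < z + (σW ^ 2 - 2 * σ ^ 2) * stieltjes σ z := by
    have hsqrt : 0 < √(z ^ 2 - 4 * σ ^ 2) := Real.sqrt_pos.2 (by nlinarith)
    have hW := mul_nonneg (sq_nonneg σW) (stieltjes_pos hσ hz).le
    rw [← sub_two_mul_stieltjes hσ hz0] at hsqrt
    linarith
  refine ⟨?_, hden⟩
  have hcont := continuousAt_stieltjes (s := σ) hz0
  have heq : z - σ ^ 2 * (stieltjes σ z + stieltjes σ z) + σW ^ 2 * stieltjes σ z =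
      z + (σW ^ 2 - 2 * σ ^ 2) * stieltjes σ z := by ring
  have hlim : ContinuousAt (fun ξ => stieltjes σ ξ /
      (z - σ ^ 2 * (stieltjes σ z + stieltjes σ ξ) + σW ^ 2 * stieltjes σ ξ)) z :=
    hcont.div (by fun_prop) (heq ▸ hden.ne')
  have ht := hlim.tendsto.mono_left (nhdsWithin_le_nhds (s := Set.Ioi (2 * σ) \ {z}))
  rw [heq] at ht
  refine ht.congr' ?_
  filter_upwards [self_mem_nhdsWithin] with ξ hξ
  exact (stieltjes_sub_div_eq hσ hz hξ.1 hξ.2).symm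
end

section
/- Let σ_H, σ_W > 0, set σ = √(σ_H² + σ_W²), and let x, y be real numbers with 0 < |x| < 2σ, 0 < |y| < 2σ and x ≠ y. Define, for complex z with Re z ≠ 0, 𝔤(z) = (z − sign(Re z)·√(z² − 4σ²)) / (2σ²) using the principal branch of the complex square root, and Ψ(z, ξ) = (𝔤(z) − 𝔤(ξ)) / (ξ − z − σ_W²·(𝔤(ξ) − 𝔤(z))). Then the limit as η → 0⁺ of Re[Ψ(x − iη, y + iη) − Ψ(x − iη, y − iη)] equals 2π²·ρ_σ(x)·ρ_σ(y)·Φ(x, y), where ρ_σ(t) = √(4σ² − t²)/(2πσ²) and Φ(x, y) = 2σ_W²·(1 − σ_W²/(2σ²))·(x − y)² / (A₊·A₋) with A_± = (σ_W⁴/(4σ⁴))·(√(4σ² − x²) ± √(4σ² − y²))² + (1 − σ_W²/(2σ²))²·(x − y)². -/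
/-- Complex Stieltjes transform `𝔤(z) = (z - sign(Re z) * √(z² - 4σ²)) / (2σ²)`, using the
    principal branch of the complex square root (branch cut along the negative real axis). -/
noncomputable def gC (σ : ℝ) (z : ℂ) : ℂ :=
  (z - ((Real.sign z.re : ℝ) : ℂ) * (z ^ 2 - ((4 * σ ^ 2 : ℝ) : ℂ)) ^ (1 / 2 : ℂ)) /
    ((2 * σ ^ 2 : ℝ) : ℂ)

/-- `Ψ(z, ξ) = (𝔤(z) - 𝔤(ξ)) / (ξ - z - σ_W² (𝔤(ξ) - 𝔤(z)))`. -/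
noncomputable def PsiC (σ σW : ℝ) (z ξ : ℂ) : ℂ :=
  (gC σ z - gC σ ξ) / (ξ - z - ((σW ^ 2 : ℝ) : ℂ) * (gC σ ξ - gC σ z))

/-- The semicircle density `ρ_σ(t) = √(4σ² - t²) / (2πσ²)`. -/
noncomputable def rhoSC (σ t : ℝ) : ℝ := Real.sqrt (4 * σ ^ 2 - t ^ 2) / (2 * Real.pi * σ ^ 2)

open Filter Topology Complex

/-- Boundary value of the principal square root on the negative axis, from below. -/
lemma tendsto_cpow_half_im_neg (r : ℝ) (hr : 0 < r) :
    Tendsto (fun u : ℂ => u ^ (1 / 2 : ℂ)) (𝓝[{u : ℂ | u.im < 0}] ((-r : ℝ) : ℂ))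
      (𝓝 (-(I * (Real.sqrt r : ℂ)))) := by
  have h := tendsto_log_nhdsWithin_im_neg_of_re_neg_of_im_zero (z := ((-r : ℝ) : ℂ))
    (by simpa using hr) (by simp)
  have h2 := (continuous_exp.tendsto _).comp (h.mul_const (1 / 2 : ℂ))
  have hv : exp ((Real.log ‖((-r : ℝ) : ℂ)‖ - Real.pi * I) * (1 / 2 : ℂ)) =
      -(I * (Real.sqrt r : ℂ)) := by
    have e1 : ((Real.log ‖((-r : ℝ) : ℂ)‖ : ℂ) - Real.pi * I) * (1 / 2 : ℂ) =
        ((Real.log r * (1 / 2) : ℝ) : ℂ) + -(Real.pi / 2 * I) := by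
      rw [norm_real, Real.norm_eq_abs, abs_neg, abs_of_pos hr]
      push_cast
      ring
    rw [e1, exp_add, exp_neg, exp_pi_div_two_mul_I, ← ofReal_exp, ← Real.rpow_def_of_pos hr,
      ← Real.sqrt_eq_rpow, inv_I]
    ring
  rw [hv] at h2
  refine h2.congr' ?_
  filter_upwards [self_mem_nhdsWithin] with u hu
  have hu0 : u ≠ 0 := by
    rintro rfl
    exact lt_irrefl (0 : ℝ) hu
  simp [cpow_def_of_ne_zero hu0]

/-- Boundary value of the principal square root on the negative axis, from above. -/
lemma tendsto_cpow_half_im_pos (r : ℝ) (hr : 0 < r) :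
    Tendsto (fun u : ℂ => u ^ (1 / 2 : ℂ)) (𝓝[{u : ℂ | 0 < u.im}] ((-r : ℝ) : ℂ))
      (𝓝 (I * (Real.sqrt r : ℂ))) := by
  have h := (tendsto_log_nhdsWithin_im_nonneg_of_re_neg_of_im_zero (z := ((-r : ℝ) : ℂ))
    (by simpa using hr) (by simp)).mono_left
      (nhdsWithin_mono _ (fun u (hu : 0 < u.im) => hu.le))
  have h2 := (continuous_exp.tendsto _).comp (h.mul_const (1 / 2 : ℂ))
  have hv : exp ((Real.log ‖((-r : ℝ) : ℂ)‖ + Real.pi * I) * (1 / 2 : ℂ)) =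
      I * (Real.sqrt r : ℂ) := by
    have e1 : ((Real.log ‖((-r : ℝ) : ℂ)‖ : ℂ) + Real.pi * I) * (1 / 2 : ℂ) =
        ((Real.log r * (1 / 2) : ℝ) : ℂ) + Real.pi / 2 * I := by
      rw [norm_real, Real.norm_eq_abs, abs_neg, abs_of_pos hr]
      push_cast
      ring
    rw [e1, exp_add, exp_pi_div_two_mul_I, ← ofReal_exp, ← Real.rpow_def_of_pos hr,
      ← Real.sqrt_eq_rpow]
    ring
  rw [hv] at h2
  refine h2.congr' ?_
  filter_upwards [self_mem_nhdsWithin] with u hu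
  have hu0 : u ≠ 0 := by
    rintro rfl
    exact lt_irrefl (0 : ℝ) hu
  simp [cpow_def_of_ne_zero hu0]

/-- Boundary values of the Stieltjes transform inside the bulk, from above (`e = 1`) or from below
(`e = -1`) the real axis. -/
lemma tendsto_gC (σ t e : ℝ) (ht0 : 0 < |t|) (ht : |t| < 2 * σ) (he : e = 1 ∨ e = -1) :
    Tendsto (fun η : ℝ => gC σ ((t : ℂ) + (e : ℂ) * ((η : ℂ) * I))) (𝓝[>] 0)
      (𝓝 (((t : ℂ) - (e : ℂ) * (I * (Real.sqrt (4 * σ ^ 2 - t ^ 2) : ℂ))) /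
        ((2 * σ ^ 2 : ℝ) : ℂ))) := by
  have hr : 0 < 4 * σ ^ 2 - t ^ 2 := by
    have := abs_lt.1 ht
    nlinarith
  have hz : Tendsto (fun η : ℝ => (t : ℂ) + (e : ℂ) * ((η : ℂ) * I)) (𝓝[>] 0) (𝓝 (t : ℂ)) := by
    have hc : Continuous (fun η : ℝ => (t : ℂ) + (e : ℂ) * ((η : ℂ) * I)) := by fun_prop
    simpa using (hc.tendsto 0).mono_left nhdsWithin_le_nhds
  have hq : Tendsto (fun η : ℝ => ((t : ℂ) + (e : ℂ) * ((η : ℂ) * I)) ^ 2 -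
      ((4 * σ ^ 2 : ℝ) : ℂ)) (𝓝[>] 0) (𝓝 ((-(4 * σ ^ 2 - t ^ 2) : ℝ) : ℂ)) := by
    have := (hz.pow 2).sub_const ((4 * σ ^ 2 : ℝ) : ℂ)
    convert this using 2
    push_cast
    ring
  have him (η : ℝ) : (((t : ℂ) + (e : ℂ) * ((η : ℂ) * I)) ^ 2 -
      ((4 * σ ^ 2 : ℝ) : ℂ)).im = 2 * (t * e) * η := by
    rw [sub_im, ofReal_im, pow_two]
    simp
    ring
  have hre (η : ℝ) : ((t : ℂ) + (e : ℂ) * ((η : ℂ) * I)).re = t := by simp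
  have hs : Tendsto (fun η : ℝ => ((Real.sign t : ℝ) : ℂ) *
      (((t : ℂ) + (e : ℂ) * ((η : ℂ) * I)) ^ 2 - ((4 * σ ^ 2 : ℝ) : ℂ)) ^ (1 / 2 : ℂ)) (𝓝[>] 0)
      (𝓝 ((e : ℂ) * (I * (Real.sqrt (4 * σ ^ 2 - t ^ 2) : ℂ)))) := by
    have ht' : t ≠ 0 := abs_pos.1 ht0
    have he' : e ≠ 0 := by rcases he with rfl | rfl <;> norm_num
    rcases lt_or_gt_of_ne (mul_ne_zero ht' he') with hte | hte
    · have hsg : Real.sign t = -e := by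
        rcases he with rfl | rfl
        · rw [Real.sign_of_neg (by linarith)]
        · rw [Real.sign_of_pos (by linarith), neg_neg]
      have h := ((tendsto_cpow_half_im_neg _ hr).comp
        (tendsto_nhdsWithin_iff.2 ⟨hq, by
          filter_upwards [self_mem_nhdsWithin] with η hη
          have hη' : 0 < η := hη
          refine (him η).trans_lt ?_
          nlinarith⟩)).const_mul ((Real.sign t : ℝ) : ℂ)
      have hv : ((Real.sign t : ℝ) : ℂ) * -(I * (Real.sqrt (4 * σ ^ 2 - t ^ 2) : ℂ)) =
          (e : ℂ) * (I * (Real.sqrt (4 * σ ^ 2 - t ^ 2) : ℂ)) := by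
        rw [hsg]
        push_cast
        ring
      rw [hv] at h
      exact h
    · have hsg : Real.sign t = e := by
        rcases he with rfl | rfl
        · rw [Real.sign_of_pos (by linarith)]
        · rw [Real.sign_of_neg (by linarith)]
      have h := ((tendsto_cpow_half_im_pos _ hr).comp
        (tendsto_nhdsWithin_iff.2 ⟨hq, by
          filter_upwards [self_mem_nhdsWithin] with η hη
          have hη' : 0 < η := hη
          refine lt_of_lt_of_eq ?_ (him η).symm
          positivity⟩)).const_mul ((Real.sign t : ℝ) : ℂ)
      rw [hsg] at h ⊢
      exact h
  simp only [gC, hre]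
  exact (hz.sub hs).div_const _

/-- Real part of a quotient of the form taken by the boundary values of `PsiC`. -/
lemma re_boundary_quotient (d c k w s : ℝ) :
    ((((d : ℂ) + (c : ℂ) * I) / (s : ℂ)) /
      (-((k : ℂ) * d) + ((w / s * c : ℝ) : ℂ) * I)).re =
    (w / s * c ^ 2 - k * d ^ 2) / s / ((w / s) ^ 2 * c ^ 2 + k ^ 2 * d ^ 2) := by
  have h1 : ((d : ℂ) + (c : ℂ) * I) / (s : ℂ) = ((d / s : ℝ) : ℂ) + ((c / s : ℝ) : ℂ) * I := by
    push_cast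
    ring
  have hn : normSq (-((k : ℂ) * d) + ((w / s * c : ℝ) : ℂ) * I) =
      (w / s) ^ 2 * c ^ 2 + k ^ 2 * d ^ 2 := by
    rw [← ofReal_mul, ← ofReal_neg, normSq_add_mul_I]
    ring
  rw [h1, div_re, hn]
  simp
  ring

/-- Limit of `PsiC` at a pair of boundary points, in terms of the limits of `gC`. -/
lemma tendsto_PsiC (σ σW x y e a b : ℝ) (hσ0 : 2 * σ ^ 2 ≠ 0)
    (hk : (1 - σW ^ 2 / (2 * σ ^ 2)) * (x - y) ≠ 0)
    (hgx : Tendsto (fun η : ℝ => gC σ ((x : ℂ) + ((-1 : ℝ) : ℂ) * ((η : ℂ) * I))) (𝓝[>] 0)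
      (𝓝 (((x : ℂ) - ((-1 : ℝ) : ℂ) * (I * (a : ℂ))) / ((2 * σ ^ 2 : ℝ) : ℂ))))
    (hgy : Tendsto (fun η : ℝ => gC σ ((y : ℂ) + (e : ℂ) * ((η : ℂ) * I))) (𝓝[>] 0)
      (𝓝 (((y : ℂ) - (e : ℂ) * (I * (b : ℂ))) / ((2 * σ ^ 2 : ℝ) : ℂ)))) :
    Tendsto (fun η : ℝ => (PsiC σ σW ((x : ℂ) + ((-1 : ℝ) : ℂ) * ((η : ℂ) * I))
        ((y : ℂ) + (e : ℂ) * ((η : ℂ) * I))).re) (𝓝[>] 0)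
      (𝓝 ((σW ^ 2 / (2 * σ ^ 2) * (a + e * b) ^ 2 -
          (1 - σW ^ 2 / (2 * σ ^ 2)) * (x - y) ^ 2) / (2 * σ ^ 2) /
        ((σW ^ 2 / (2 * σ ^ 2)) ^ 2 * (a + e * b) ^ 2 +
          (1 - σW ^ 2 / (2 * σ ^ 2)) ^ 2 * (x - y) ^ 2))) := by
  have hz (t e : ℝ) : Tendsto (fun η : ℝ => (t : ℂ) + (e : ℂ) * ((η : ℂ) * I)) (𝓝[>] 0)
      (𝓝 (t : ℂ)) := by
    have hc : Continuous (fun η : ℝ => (t : ℂ) + (e : ℂ) * ((η : ℂ) * I)) := by fun_prop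
    simpa using (hc.tendsto 0).mono_left nhdsWithin_le_nhds
  have hs : ((2 * σ ^ 2 : ℝ) : ℂ) ≠ 0 := ofReal_ne_zero.2 hσ0
  rw [← re_boundary_quotient (x - y) (a + e * b)]
  have hN := hgx.sub hgy
  have hD := ((hz y e).sub (hz x (-1))).sub ((hgy.sub hgx).const_mul ((σW ^ 2 : ℝ) : ℂ))
  have eN : ((x : ℂ) - ((-1 : ℝ) : ℂ) * (I * (a : ℂ))) / ((2 * σ ^ 2 : ℝ) : ℂ) -
      ((y : ℂ) - (e : ℂ) * (I * (b : ℂ))) / ((2 * σ ^ 2 : ℝ) : ℂ) =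
      (((x - y : ℝ) : ℂ) + ((a + e * b : ℝ) : ℂ) * I) / ((2 * σ ^ 2 : ℝ) : ℂ) := by
    push_cast
    ring
  have eD : (y : ℂ) - x - ((σW ^ 2 : ℝ) : ℂ) *
      (((y : ℂ) - (e : ℂ) * (I * (b : ℂ))) / ((2 * σ ^ 2 : ℝ) : ℂ) -
        ((x : ℂ) - ((-1 : ℝ) : ℂ) * (I * (a : ℂ))) / ((2 * σ ^ 2 : ℝ) : ℂ)) =
      -(((1 - σW ^ 2 / (2 * σ ^ 2) : ℝ) : ℂ) * ((x - y : ℝ) : ℂ)) +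
        ((σW ^ 2 / (2 * σ ^ 2) * (a + e * b) : ℝ) : ℂ) * I := by
    push_cast
    ring
  rw [eN] at hN
  rw [eD] at hD
  refine (continuous_re.tendsto _).comp (hN.div hD ?_)
  intro h0
  have := congrArg re h0
  rw [← ofReal_mul, ← ofReal_neg] at this
  simp only [add_re, ofReal_re, re_ofReal_mul, I_re, mul_zero, add_zero, zero_re,
    neg_eq_zero] at this
  exact hk this

theorem stmt_18 (σH σW σ x y : ℝ) (hσH : 0 < σH) (hσW : 0 < σW)
    (hσ : σ = Real.sqrt (σH ^ 2 + σW ^ 2))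
    (hx0 : 0 < |x|) (hx : |x| < 2 * σ)
    (hy0 : 0 < |y|) (hy : |y| < 2 * σ) (hxy : x ≠ y) :
    Filter.Tendsto (fun η : ℝ =>
        (PsiC σ σW ((x : ℂ) - (η : ℂ) * Complex.I) ((y : ℂ) + (η : ℂ) * Complex.I) -
          PsiC σ σW ((x : ℂ) - (η : ℂ) * Complex.I) ((y : ℂ) - (η : ℂ) * Complex.I)).re)
      (nhdsWithin 0 (Set.Ioi 0))
      (nhds (2 * Real.pi ^ 2 * rhoSC σ x * rhoSC σ y *
        (2 * σW ^ 2 * (1 - σW ^ 2 / (2 * σ ^ 2)) * (x - y) ^ 2 /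
          (((σW ^ 4 / (4 * σ ^ 4)) *
              (Real.sqrt (4 * σ ^ 2 - x ^ 2) + Real.sqrt (4 * σ ^ 2 - y ^ 2)) ^ 2 +
              (1 - σW ^ 2 / (2 * σ ^ 2)) ^ 2 * (x - y) ^ 2) *
            ((σW ^ 4 / (4 * σ ^ 4)) *
              (Real.sqrt (4 * σ ^ 2 - x ^ 2) - Real.sqrt (4 * σ ^ 2 - y ^ 2)) ^ 2 +
              (1 - σW ^ 2 / (2 * σ ^ 2)) ^ 2 * (x - y) ^ 2))))) := by
  have hW : 0 < σW ^ 2 := by positivity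
  have hH : 0 < σH ^ 2 := by positivity
  have hσ2 : σ ^ 2 = σH ^ 2 + σW ^ 2 := by rw [hσ, Real.sq_sqrt (by positivity)]
  have hσpos : 0 < σ ^ 2 := by linarith
  have hσ0 : σ ≠ 0 := fun h => by simp [h] at hσpos
  have hk : 0 < 1 - σW ^ 2 / (2 * σ ^ 2) := by
    rw [sub_pos, div_lt_one (by linarith)]
    linarith
  have hd : x - y ≠ 0 := sub_ne_zero.2 hxy
  have hkd := mul_ne_zero hk.ne' hd
  have hs0 : 2 * σ ^ 2 ≠ 0 := by linarith
  have hgx := tendsto_gC σ x (-1) hx0 hx (Or.inr rfl)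
  have h1 := tendsto_PsiC σ σW x y 1 _ _ hs0 hkd hgx (tendsto_gC σ y 1 hy0 hy (Or.inl rfl))
  have h2 := tendsto_PsiC σ σW x y (-1) _ _ hs0 hkd hgx (tendsto_gC σ y (-1) hy0 hy (Or.inr rfl))
  have h := h1.sub h2
  simp only [ofReal_one, ofReal_neg, one_mul, neg_mul, ← sub_eq_add_neg, ← sub_re] at h
  convert h using 2
  simp only [rhoSC]
  generalize Real.sqrt (4 * σ ^ 2 - x ^ 2) = a
  generalize Real.sqrt (4 * σ ^ 2 - y ^ 2) = b
  have ht : σW ^ 4 / (4 * σ ^ 4) = (σW ^ 2 / (2 * σ ^ 2)) ^ 2 := by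
    field_simp
    ring
  have hρ : 2 * Real.pi ^ 2 * (a / (2 * Real.pi * σ ^ 2)) * (b / (2 * Real.pi * σ ^ 2)) =
      2 * (a * b) / (2 * σ ^ 2) ^ 2 := by
    have := Real.pi_ne_zero
    field_simp
  have hw : σW ^ 2 = σW ^ 2 / (2 * σ ^ 2) * (2 * σ ^ 2) := (div_mul_cancel₀ _ hs0).symm
  rw [ht, hρ]
  generalize hT : σW ^ 2 / (2 * σ ^ 2) = T at *
  rw [hw]
  have hpos (c : ℝ) : T ^ 2 * c ^ 2 + (1 - T) ^ 2 * (x - y) ^ 2 ≠ 0 := by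
    have : 0 < ((1 - T) * (x - y)) ^ 2 := by positivity
    nlinarith [sq_nonneg (T * c)]
  have hA := hpos (a + b)
  have hB := hpos (a - b)
  generalize 2 * σ ^ 2 = s at *
  rw [div_sub_div _ _ hA hB, ← mul_div_assoc, div_eq_div_iff (mul_ne_zero hA hB)
    (mul_ne_zero hA hB)]
  congr 1
  field_simp
  ring
end

section
/- Let σ, Δ > 0 with Δ ≠ σ, and let μ be a nonzero real number with μ² − 4(σ² − Δ²) ≥ 0. Define λ_± = (2μσ² − Δ²μ ± sign(μ)·Δ²·√(μ² − 4(σ² − Δ²))) / (2(σ² − Δ²)). Then for every real x with |x| > 2σ the factorization identity (x − μ − Δ²·𝔤_σ(x)) · ((1 − Δ²/(2σ²))·x − μ − sign(x)·(Δ²/(2σ²))·√(x² − 4σ²)) = (1 − Δ²/σ²)·(x − λ₊)·(x − λ₋) holds. -/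
theorem Real.sign_mul_sqrt_sq {a b : ℝ} (ha : a ≠ 0) (hb : 0 ≤ b) :
    (Real.sign a * Real.sqrt b) ^ 2 = b := by
  rw [mul_pow, Real.sq_sqrt hb]
  rcases Real.sign_apply_eq_of_ne_zero a ha with h | h <;> simp [h]

theorem stmt_19 (σ Δ μ : ℝ) (hσ : 0 < σ) (hΔ : 0 < Δ) (hne : Δ ≠ σ) (hμ : μ ≠ 0)
    (hdisc : 0 ≤ μ ^ 2 - 4 * (σ ^ 2 - Δ ^ 2)) :
    ∀ x : ℝ, 2 * σ < |x| →
      (x - μ - Δ ^ 2 * stieltjes σ x) *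
        ((1 - Δ ^ 2 / (2 * σ ^ 2)) * x - μ -
          Real.sign x * (Δ ^ 2 / (2 * σ ^ 2)) * Real.sqrt (x ^ 2 - 4 * σ ^ 2))
      = (1 - Δ ^ 2 / σ ^ 2) *
          (x - (2 * μ * σ ^ 2 - Δ ^ 2 * μ +
              Real.sign μ * Δ ^ 2 * Real.sqrt (μ ^ 2 - 4 * (σ ^ 2 - Δ ^ 2))) /
            (2 * (σ ^ 2 - Δ ^ 2))) *
          (x - (2 * μ * σ ^ 2 - Δ ^ 2 * μ -
              Real.sign μ * Δ ^ 2 * Real.sqrt (μ ^ 2 - 4 * (σ ^ 2 - Δ ^ 2))) /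
            (2 * (σ ^ 2 - Δ ^ 2))) := by
  intro x hx
  have hD : σ ^ 2 - Δ ^ 2 ≠ 0 := fun h =>
    hne (((sq_eq_sq₀ hσ.le hΔ.le).1 (sub_eq_zero.1 h)).symm)
  have hx0 : x ≠ 0 := abs_pos.1 (by linarith)
  have hx2 : 0 ≤ x ^ 2 - 4 * σ ^ 2 := by
    nlinarith [sq_abs x]
  have hu := Real.sign_mul_sqrt_sq hx0 hx2
  have hv := Real.sign_mul_sqrt_sq hμ hdisc
  rw [mul_right_comm (Real.sign x), mul_right_comm (Real.sign μ), stieltjes]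
  generalize Real.sign x * Real.sqrt (x ^ 2 - 4 * σ ^ 2) = u at *
  generalize Real.sign μ * Real.sqrt (μ ^ 2 - 4 * (σ ^ 2 - Δ ^ 2)) = v at *
  linear_combination (norm := (field_simp; ring))
    -(Δ ^ 2 / (2 * σ ^ 2)) ^ 2 * hu + Δ ^ 4 / (4 * σ ^ 2 * (σ ^ 2 - Δ ^ 2)) * hv
end
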